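/- Let S be a strictly proper scoring rule with G, g, f differentiable. If p ∈ int(Δ) is both a fixed point of f and a performatively optimal report, then either the linear map Df(p) restricted to the tangent space T is singular, or g(p) = 0. -/

import Mathlib

open Set
open scoped RealInnerProductSpace

noncomputable section

/-- The probability simplex over `n` outcomes, inside Euclidean space. -/
def probSimplex (n : ℕ) : Set (EuclideanSpace ℝ (Fin n)) :=
  {p | (∀ i, 0 ≤ p i) ∧ ∑ i, p i = 1}

/-- The tangent space `T` of the probability simplex: vectors with coordinates summing to 0. -/
def tangentSp (n : ℕ) : Set (EuclideanSpace ℝ (Fin n)) :=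
  {v | ∑ i, v i = 0}

/-- The tangent space of the simplex as a submodule. -/
def tangentSubmodule (n : ℕ) : Submodule ℝ (EuclideanSpace ℝ (Fin n)) where
  carrier := tangentSp n
  zero_mem' := by simp [tangentSp]
  add_mem' := by
    intro a b ha hb
    simp only [tangentSp, mem_ofPred_eq, PiLp.add_apply, Finset.sum_add_distrib] at *
    rw [ha, hb, add_zero]
  smul_mem' := by
    intro c a ha
    simp only [tangentSp, mem_ofPred_eq, PiLp.smul_apply, smul_eq_mul, ← Finset.mul_sum] at *
    rw [ha, mul_zero]

/-- Moving an interior point of the simplex a little along a tangent vector stays in the simplex. -/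
lemma eventually_add_smul_mem_probSimplex {n : ℕ} {p v : EuclideanSpace ℝ (Fin n)}
    (hp : p ∈ probSimplex n) (hpint : ∀ i, 0 < p i) (hv : v ∈ tangentSp n) :
    ∀ᶠ t : ℝ in nhds 0, p + t • v ∈ probSimplex n := by
  have hpos : ∀ᶠ t : ℝ in nhds 0, ∀ i, 0 < p i + t * v i := by
    rw [Filter.eventually_all]
    intro i
    have hc : ContinuousAt (fun t : ℝ => p i + t * v i) 0 := by fun_prop
    exact hc.eventually (lt_mem_nhds (by simpa using hpint i))
  filter_upwards [hpos] with t ht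
  refine ⟨fun i => by simpa using (ht i).le, ?_⟩
  have hp1 : ∑ i, p i = 1 := hp.2
  have hv0 : ∑ i, v i = 0 := hv
  simp [Finset.sum_add_distrib, ← Finset.mul_sum, hp1, hv0]

/-- The directional derivative of a simplex-valued map is tangent to the simplex. -/
lemma HasDerivAt.mem_tangentSp {n : ℕ} {c : ℝ → EuclideanSpace ℝ (Fin n)}
    {c' : EuclideanSpace ℝ (Fin n)} {t : ℝ} (hc : HasDerivAt c c' t)
    (hmem : ∀ᶠ s in nhds t, c s ∈ probSimplex n) : c' ∈ tangentSp n := by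
  have hsum : HasDerivAt (fun s => ∑ i, c s i) (∑ i, c' i) t :=
    HasDerivAt.fun_sum fun i _ =>
      (EuclideanSpace.proj (𝕜 := ℝ) i).hasFDerivAt.comp_hasDerivAt t hc
  have hconst : (fun s => ∑ i, c s i) =ᶠ[nhds t] fun _ => (1 : ℝ) := hmem.mono fun _ h => h.2
  exact hsum.unique ((hasDerivAt_const t (1 : ℝ)).congr_of_eventuallyEq hconst)

/-- Let `S(x,q) = G x + ⟪g x, q - x⟫` be a strictly proper scoring rule
(`G` strictly convex on the simplex, `g` a subgradient of `G` taking values in the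
tangent space `T`), with `G`, `g`, `f` differentiable. If `p ∈ int Δ` is both a fixed point
of `f` and a performatively optimal report, then either `Df(p)` restricted to `T` is
singular, or `g p = 0`. -/
theorem stmt2 (n : ℕ)
    (G : EuclideanSpace ℝ (Fin n) → ℝ)
    (g f : EuclideanSpace ℝ (Fin n) → EuclideanSpace ℝ (Fin n))
    (hG : StrictConvexOn ℝ (probSimplex n) G)
    (hsub : ∀ q ∈ probSimplex n, ∀ r ∈ probSimplex n, G q + ⟪g q, r - q⟫ ≤ G r)
    (hgT : ∀ q ∈ probSimplex n, g q ∈ tangentSp n)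
    (hf : ∀ q ∈ probSimplex n, f q ∈ probSimplex n)
    (p : EuclideanSpace ℝ (Fin n)) (hp : p ∈ probSimplex n) (hpint : ∀ i, 0 < p i)
    (Dg Df : EuclideanSpace ℝ (Fin n) →L[ℝ] EuclideanSpace ℝ (Fin n))
    (hG' : ∀ v ∈ tangentSp n, HasDerivAt (fun t : ℝ => G (p + t • v)) ⟪g p, v⟫ 0)
    (hg' : ∀ v ∈ tangentSp n, HasDerivAt (fun t : ℝ => g (p + t • v)) (Dg v) 0)
    (hf' : ∀ v ∈ tangentSp n, HasDerivAt (fun t : ℝ => f (p + t • v)) (Df v) 0)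
    (hfix : f p = p)
    (hopt : ∀ q ∈ probSimplex n, G q + ⟪g q, f q - q⟫ ≤ G p + ⟪g p, f p - p⟫) :
    (∃ v ∈ tangentSp n, v ≠ 0 ∧ Df v = 0) ∨ g p = 0 := by
  by_contra! hcon
  obtain ⟨hinj, hgp⟩ := hcon
  have hmem := fun v hv => eventually_add_smul_mem_probSimplex (v := v) hp hpint hv
  have hDfT : ∀ v ∈ tangentSubmodule n, Df.toLinearMap v ∈ tangentSubmodule n := fun v hv =>
    (hf' v hv).mem_tangentSp ((hmem v hv).mono fun t ht => hf _ ht)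
  have horth : ∀ v ∈ tangentSp n, ⟪g p, Df v⟫ = 0 := by
    intro v hv
    have hline : HasDerivAt (fun t : ℝ => p + t • v) v 0 := by
      simpa using ((hasDerivAt_id (0 : ℝ)).smul_const v).const_add p
    have hderiv := (hG' v hv).add ((hg' v hv).inner ℝ ((hf' v hv).sub hline))
    have hmax : IsLocalMax
        (fun t : ℝ => G (p + t • v) + ⟪g (p + t • v), f (p + t • v) - (p + t • v)⟫) 0 := by
      filter_upwards [hmem v hv] with t ht
      simpa using hopt _ ht
    have hzero := hmax.hasDerivAt_eq_zero hderiv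
    simpa [hfix, inner_sub_right] using hzero
  have hinjT : Function.Injective (Df.toLinearMap.restrict hDfT) := by
    rw [← LinearMap.ker_eq_bot, LinearMap.ker_eq_bot']
    intro v hv
    by_contra hne
    exact hinj v v.2 (by simpa using hne) (congrArg Subtype.val hv)
  obtain ⟨v, hv⟩ := LinearMap.injective_iff_surjective.mp hinjT ⟨g p, hgT p hp⟩
  have hDfv : Df v = g p := congrArg Subtype.val hv
  have hself := horth v v.2
  rw [hDfv] at hself
  exact hgp (inner_self_eq_zero.mp hself)
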